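/- arXiv:2504.19370 — 4 statements merged into one kernel-verified Lean document; each statement's English description precedes it below -/
import Mathlib

section
/- Let G_r and G_a be finite nonempty sets with injective score functions s_r : G_r → ℝ and s_a : G_a → ℝ, all of whose values lie in the open interval (−1,1). Write n = |G_r|, m = |G_a|, let F_r and F_a be the empirical CDFs of (G_r, s_r) and (G_a, s_a), and let F_r⁻¹ be the generalized inverse of F_r. Define the transformed-score CDF F_{a→r}(t) = (1/m)·|{x ∈ G_a : F_r⁻¹(F_a(s_a(x))) ≤ t}|. Then for every t ∈ (−1,1), |F_{a→r}(t) − F_r(t)| ≤ 1/m. -/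
/-- Empirical cumulative distribution function of the scores `s` on the finite set `G`:
`F(t) = |{x : s x ≤ t}| / |G|`. -/
noncomputable def ecdf {G : Type*} [Fintype G] (s : G → ℝ) (t : ℝ) : ℝ :=
  ((Finset.univ.filter (fun x => s x ≤ t)).card : ℝ) / (Fintype.card G : ℝ)

/-- Generalized inverse (quantile function) of the empirical CDF:
`F⁻¹(α) = inf {t : F(t) ≥ α}`. -/
noncomputable def equantile {G : Type*} [Fintype G] (s : G → ℝ) (α : ℝ) : ℝ :=
  sInf {t : ℝ | α ≤ ecdf s t}

/-- Empirical survival function of the scores `s` on the finite set `G`: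
`S(t) = |{x : s x > t}| / |G|`. -/
noncomputable def esurv {G : Type*} [Fintype G] (s : G → ℝ) (t : ℝ) : ℝ :=
  ((Finset.univ.filter (fun x => s x > t)).card : ℝ) / (Fintype.card G : ℝ)

/-- Generalized inverse of the empirical survival function, defined through the
CDF `1 - S`: `S⁻¹(α) = inf {t : 1 - S(t) ≥ 1 - α}`. -/
noncomputable def esurvInv {G : Type*} [Fintype G] (s : G → ℝ) (α : ℝ) : ℝ :=
  sInf {t : ℝ | 1 - α ≤ 1 - esurv s t}

theorem ecdf_mono_aux {G : Type*} [Fintype G] (s : G → ℝ) {t u : ℝ} (h : t ≤ u) :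
    ecdf s t ≤ ecdf s u := by
  unfold ecdf
  gcongr

theorem equantile_le_iff_aux {G : Type*} [Fintype G] [Nonempty G] (s : G → ℝ)
    (hs : ∀ x, s x ∈ Set.Ioo (-1 : ℝ) 1) (α : ℝ) (h0 : 0 < α) (h1 : α ≤ 1) (t : ℝ) :
    equantile s α ≤ t ↔ α ≤ ecdf s t := by
  unfold equantile
  have hpos : (0 : ℝ) < Fintype.card G := by exact_mod_cast Fintype.card_pos
  constructor
  · intro h
    have hne : {t : ℝ | α ≤ ecdf s t}.Nonempty := by
      refine ⟨1, ?_⟩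
      have : ecdf s 1 = 1 := by
        unfold ecdf
        rw [Finset.filter_true_of_mem (fun x _ => (hs x).2.le), Finset.card_univ,
          div_self hpos.ne']
      simpa [this] using h1
    have hev : ∀ᶠ u in nhdsWithin t (Set.Ioi t), ∀ x, s x ≤ u → s x ≤ t := by
      rw [Filter.eventually_all]
      intro x
      by_cases hx : s x ≤ t
      · exact Filter.Eventually.of_forall fun _ _ => hx
      · push Not at hx
        filter_upwards [Ioo_mem_nhdsGT hx] with u hu hxu
        exact absurd hu.2 (not_lt.mpr hxu)
    obtain ⟨u, hu, htu⟩ := (hev.and self_mem_nhdsWithin).exists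
    obtain ⟨v, hv, hvu⟩ := exists_lt_of_csInf_lt hne (lt_of_le_of_lt h htu)
    refine le_trans (le_trans hv (ecdf_mono_aux s hvu.le)) ?_
    unfold ecdf
    refine div_le_div_of_nonneg_right ?_ hpos.le
    exact_mod_cast Finset.card_le_card (Finset.monotone_filter_right _ fun x _ => hu x)
  · intro h
    refine csInf_le ⟨-1, ?_⟩ h
    intro u hu
    by_contra hlt
    push Not at hlt
    have : ecdf s u = 0 := by
      unfold ecdf
      rw [Finset.filter_false_of_mem]
      · simp
      · intro x _ hx
        have := (hs x).1
        linarith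
    have hu' : α ≤ ecdf s u := hu
    linarith

theorem card_rank_aux {G : Type*} [Fintype G] (s : G → ℝ) (hs : Function.Injective s) (k : ℕ)
    (hk : k ≤ Fintype.card G) :
    (Finset.univ.filter
      (fun x => (Finset.univ.filter (fun y => s y ≤ s x)).card ≤ k)).card = k := by
  classical
  set r : G → ℕ := fun x => (Finset.univ.filter (fun y => s y ≤ s x)).card with hr
  have hlt : ∀ x y, s x < s y → r x < r y := by
    intro x y h
    refine Finset.card_lt_card ?_
    rw [Finset.ssubset_iff_of_subset]
    · exact ⟨y, by simp, by simpa using h⟩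
    · intro z hz
      simp only [Finset.mem_filter, Finset.mem_univ, true_and] at hz ⊢
      linarith
  have hinj : Function.Injective r := by
    intro x y h
    by_contra hne
    rcases lt_or_gt_of_ne (fun e => hne (hs e)) with h' | h'
    · exact absurd h (hlt _ _ h').ne
    · exact absurd h (hlt _ _ h').ne'
  have himg : Finset.univ.image r = Finset.Icc 1 (Fintype.card G) := by
    apply Finset.eq_of_subset_of_card_le
    · intro n hn
      obtain ⟨x, _, rfl⟩ := Finset.mem_image.mp hn
      exact Finset.mem_Icc.mpr ⟨Finset.card_pos.mpr ⟨x, by simp⟩, Finset.card_le_univ _⟩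
    · rw [Finset.card_image_of_injective _ hinj]
      simp
  have h2 : (Finset.univ.filter (fun x => r x ≤ k)).image r = Finset.Icc 1 k := by
    ext n
    have hn : n ∈ Finset.univ.image r ↔ n ∈ Finset.Icc 1 (Fintype.card G) := by rw [himg]
    simp only [Finset.mem_image, Finset.mem_univ, true_and, Finset.mem_Icc,
      Finset.mem_filter] at hn ⊢
    constructor
    · rintro ⟨x, hx, rfl⟩
      exact ⟨(hn.mp ⟨x, rfl⟩).1, hx⟩
    · rintro ⟨h1, h3⟩
      obtain ⟨x, rfl⟩ := hn.mpr ⟨h1, h3.trans hk⟩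
      exact ⟨x, h3, rfl⟩
  rw [← Finset.card_image_of_injective _ hinj, h2]
  simp

/-- **Proposition 1 (FRR half).** Aligning the genuine pseudo-scores of group `a`
onto the reference group `r` via `T(s) = F_r⁻¹(F_a(s))` yields an empirical CDF
uniformly within `1/|G_a|` of the reference empirical CDF on `(-1,1)`. -/
theorem frr_alignment {Gr Ga : Type*} [Fintype Gr] [Fintype Ga] [Nonempty Gr] [Nonempty Ga]
    (sr : Gr → ℝ) (sa : Ga → ℝ)
    (hr_inj : Function.Injective sr) (ha_inj : Function.Injective sa)
    (hr_mem : ∀ x, sr x ∈ Set.Ioo (-1 : ℝ) 1) (ha_mem : ∀ x, sa x ∈ Set.Ioo (-1 : ℝ) 1)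
    (t : ℝ) (ht : t ∈ Set.Ioo (-1 : ℝ) 1) :
    |ecdf (fun x => equantile sr (ecdf sa (sa x))) t - ecdf sr t|
      ≤ 1 / (Fintype.card Ga : ℝ) := by
  have hm : (0 : ℝ) < Fintype.card Ga := by exact_mod_cast Fintype.card_pos
  have hn : (0 : ℝ) < Fintype.card Gr := by exact_mod_cast Fintype.card_pos
  have hp0 : 0 ≤ ecdf sr t := by unfold ecdf; positivity
  have hp1 : ecdf sr t ≤ 1 := by
    unfold ecdf
    rw [div_le_one hn]
    exact_mod_cast Finset.card_le_univ _
  have hiff : ∀ x, equantile sr (ecdf sa (sa x)) ≤ t ↔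
      (Finset.univ.filter (fun y => sa y ≤ sa x)).card
        ≤ ⌊(Fintype.card Ga : ℝ) * ecdf sr t⌋₊ := by
    intro x
    rw [equantile_le_iff_aux sr hr_mem, Nat.le_floor_iff (by positivity)]
    · conv_lhs => rw [ecdf, div_le_iff₀' hm]
    · have : 0 < (Finset.univ.filter (fun y => sa y ≤ sa x)).card :=
        Finset.card_pos.mpr ⟨x, by simp⟩
      unfold ecdf
      positivity
    · unfold ecdf
      rw [div_le_one hm]
      exact_mod_cast Finset.card_le_univ _
  have hk : ⌊(Fintype.card Ga : ℝ) * ecdf sr t⌋₊ ≤ Fintype.card Ga := by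
    apply Nat.floor_le_of_le
    nlinarith
  have hF : ecdf (fun x => equantile sr (ecdf sa (sa x))) t
      = (⌊(Fintype.card Ga : ℝ) * ecdf sr t⌋₊ : ℝ) / Fintype.card Ga := by
    conv_lhs => rw [ecdf]
    simp only [hiff]
    rw [card_rank_aux sa ha_inj _ hk]
  rw [hF]
  have h1 := Nat.floor_le (mul_nonneg hm.le hp0)
  have h2 := Nat.lt_floor_add_one ((Fintype.card Ga : ℝ) * ecdf sr t)
  have h3 : ∀ k : ℝ, k / Fintype.card Ga - ecdf sr t
      = (k - Fintype.card Ga * ecdf sr t) / Fintype.card Ga := by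
    intro k
    field_simp
  rw [h3, abs_div, abs_of_pos hm]
  gcongr
  rw [abs_le]
  constructor <;> linarith
end

section
/- Let I_r and I_a be finite nonempty sets with injective score functions s_r : I_r → ℝ and s_a : I_a → ℝ, all of whose values lie in the open interval (−1,1). Write n = |I_r|, m = |I_a|, let S_r and S_a be the empirical survival functions of (I_r, s_r) and (I_a, s_a), and let S_r⁻¹(α) = inf{t ∈ ℝ : 1 − S_r(t) ≥ 1 − α} for α ∈ [0,1). Define the transformed-score survival function S_{a→r}(t) = (1/m)·|{x ∈ I_a : S_r⁻¹(S_a(s_a(x))) > t}|. Then for every t ∈ (−1,1), |S_{a→r}(t) − S_r(t)| ≤ 1/m. -/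
lemma esurv_mono_aux {G : Type*} [Fintype G] (s : G → ℝ) (u v : ℝ)
    (h : ∀ x, s x > v → s x > u) : esurv s v ≤ esurv s u := by
  unfold esurv
  refine div_le_div_of_nonneg_right ?_ (Nat.cast_nonneg _)
  exact_mod_cast Finset.card_le_card (Finset.monotone_filter_right _ (fun x _ hx => h x hx))

lemma esurvInv_gt_iff {G : Type*} [Fintype G] [Nonempty G] (s : G → ℝ)
    (hs : ∀ x, s x ∈ Set.Ioo (-1 : ℝ) 1) (α t : ℝ) (h0 : 0 ≤ α) (h1 : α < 1) :
    esurvInv s α > t ↔ α < esurv s t := by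
  have hb : BddBelow {t : ℝ | 1 - α ≤ 1 - esurv s t} := by
    refine ⟨-1, ?_⟩
    intro u hu
    by_contra! hlt
    have : esurv s u = 1 := by
      unfold esurv
      rw [Finset.filter_true_of_mem]
      · simp
      · intro x _
        have := (hs x).1
        linarith
    simp only [Set.mem_ofPred_eq] at hu
    linarith
  constructor
  · intro h
    by_contra! hle
    have : esurvInv s α ≤ t := csInf_le hb (by simp only [Set.mem_ofPred_eq]; linarith)
    linarith
  · intro h
    have hev : ∀ᶠ u in nhdsWithin t (Set.Ioi t), ∀ x, s x > t → u < s x := by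
      rw [Filter.eventually_all]
      intro x
      by_cases hx : s x > t
      · filter_upwards [Ioo_mem_nhdsGT hx] with u hu _
        exact hu.2
      · exact Filter.Eventually.of_forall fun u h => absurd h hx
    obtain ⟨e, he, het⟩ := (hev.and self_mem_nhdsWithin).exists
    have het : t < e := het
    refine lt_of_lt_of_le het (le_csInf ⟨1, ?_⟩ ?_)
    · have : esurv s 1 = 0 := by
        unfold esurv
        rw [Finset.filter_false_of_mem]
        · simp
        · intro x _
          have := (hs x).2
          linarith
      simp only [Set.mem_ofPred_eq]
      linarith
    · intro u hu
      by_contra! hlt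
      have := esurv_mono_aux s u t (fun x hx => hlt.trans (he x hx))
      simp only [Set.mem_ofPred_eq] at hu
      linarith

lemma card_rank_lt {G : Type*} [Fintype G] (s : G → ℝ) (hs : Function.Injective s)
    (b : ℕ) (hb : b ≤ Fintype.card G) :
    (Finset.univ.filter (fun x => (Finset.univ.filter (fun y => s y > s x)).card < b)).card
      = b := by
  classical
  let k : G → ℕ := fun x => (Finset.univ.filter (fun y => s y > s x)).card
  have hk : ∀ x, k x < Fintype.card G := by
    intro x
    apply Finset.card_lt_univ_of_notMem (x := x)
    simp
  have hlt : ∀ x y, s x < s y → k y < k x := by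
    intro x y h
    apply Finset.card_lt_card
    rw [Finset.ssubset_iff_of_subset]
    · exact ⟨y, by simpa using h, by simp⟩
    · intro z hz
      simp only [Finset.mem_filter, Finset.mem_univ, true_and] at hz ⊢
      exact h.trans hz
  have hinj : Function.Injective k := by
    intro x y h
    rcases lt_trichotomy (s x) (s y) with h' | h' | h'
    · have := hlt _ _ h'; omega
    · exact hs h'
    · have := hlt _ _ h'; omega
  have himg : Finset.univ.image k = Finset.range (Fintype.card G) := by
    apply Finset.eq_of_subset_of_card_le
    · intro z hz
      simp only [Finset.mem_image, Finset.mem_univ, true_and] at hz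
      obtain ⟨x, rfl⟩ := hz
      simpa using hk x
    · rw [Finset.card_image_of_injective _ hinj]
      simp
  have : (Finset.univ.filter (fun x => k x < b)).image k = Finset.range b := by
    ext z
    have hz := Finset.ext_iff.1 himg z
    simp only [Finset.mem_image, Finset.mem_univ, true_and, Finset.mem_range,
      Finset.mem_filter] at hz ⊢
    constructor
    · rintro ⟨x, hx, rfl⟩
      exact hx
    · intro h
      obtain ⟨x, rfl⟩ := hz.2 (by omega)
      exact ⟨x, h, rfl⟩
  have h2 := congrArg Finset.card this
  rw [Finset.card_image_of_injective _ hinj, Finset.card_range] at h2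
  exact h2

/-- **Proposition 1 (FAR half).** Aligning the impostor pseudo-scores of group `a`
onto the reference group `r` via `T(s) = S_r⁻¹(S_a(s))` yields an empirical survival
function uniformly within `1/|I_a|` of the reference one on `(-1,1)`. -/
theorem far_alignment {Ir Ia : Type*} [Fintype Ir] [Fintype Ia] [Nonempty Ir] [Nonempty Ia]
    (sr : Ir → ℝ) (sa : Ia → ℝ)
    (hr_inj : Function.Injective sr) (ha_inj : Function.Injective sa)
    (hr_mem : ∀ x, sr x ∈ Set.Ioo (-1 : ℝ) 1) (ha_mem : ∀ x, sa x ∈ Set.Ioo (-1 : ℝ) 1)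
    (t : ℝ) (ht : t ∈ Set.Ioo (-1 : ℝ) 1) :
    |esurv (fun x => esurvInv sr (esurv sa (sa x))) t - esurv sr t|
      ≤ 1 / (Fintype.card Ia : ℝ) := by
  have hm : (0 : ℝ) < Fintype.card Ia := by exact_mod_cast Fintype.card_pos
  have hn : (0 : ℝ) < Fintype.card Ir := by exact_mod_cast Fintype.card_pos
  set β := esurv sr t with hβ
  have hβ0 : 0 ≤ β := by rw [hβ]; unfold esurv; positivity
  have hβ1 : β ≤ 1 := by
    rw [hβ]; unfold esurv
    rw [div_le_one hn]
    exact_mod_cast Finset.card_le_univ _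
  have hiff : ∀ x, esurvInv sr (esurv sa (sa x)) > t ↔
      (Finset.univ.filter (fun y => sa y > sa x)).card < ⌈Fintype.card Ia * β⌉₊ := by
    intro x
    rw [esurvInv_gt_iff sr hr_mem, Nat.lt_ceil, ← hβ]
    · unfold esurv
      rw [div_lt_iff₀ hm, mul_comm]
    · unfold esurv; positivity
    · unfold esurv
      rw [div_lt_one hm]
      exact_mod_cast Finset.card_lt_univ_of_notMem (x := x) (by simp)
  have hc : esurv (fun x => esurvInv sr (esurv sa (sa x))) t
      = (⌈Fintype.card Ia * β⌉₊ : ℝ) / Fintype.card Ia := by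
    rw [esurv]
    simp only [hiff]
    rw [card_rank_lt sa ha_inj]
    rw [Nat.ceil_le]
    nlinarith
  rw [hc]
  have h1 := Nat.le_ceil (Fintype.card Ia * β)
  have h2 := Nat.ceil_lt_add_one (mul_nonneg hm.le hβ0)
  have : (⌈Fintype.card Ia * β⌉₊ : ℝ) / Fintype.card Ia - β
      = (⌈Fintype.card Ia * β⌉₊ - Fintype.card Ia * β) / Fintype.card Ia := by
    field_simp
  rw [this, abs_of_nonneg (div_nonneg (by linarith) hm.le)]
  gcongr
  linarith
end

section
/- Let G_r and G_a be finite nonempty sets with injective score functions s_r : G_r → ℝ and s_a : G_a → ℝ. Write n = |G_r|, m = |G_a|, let F_r and F_a be the empirical CDFs of (G_r, s_r) and (G_a, s_a), let F_r⁻¹ be the generalized inverse of F_r, and define F_{a→r}(t) = (1/m)·|{x ∈ G_a : F_r⁻¹(F_a(s_a(x))) ≤ t}|. Then for every integer l with 1 ≤ l ≤ n, F_{a→r}(F_r⁻¹(l/n)) = ⌊l·m/n⌋ / m. -/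
noncomputable def erank {G : Type*} [Fintype G] (s : G → ℝ) (t : ℝ) : ℕ :=
  (Finset.univ.filter (fun x => s x ≤ t)).card

lemma erank_mono {G : Type*} [Fintype G] (s : G → ℝ) {t u : ℝ} (h : t ≤ u) :
    erank s t ≤ erank s u := by
  apply Finset.card_le_card
  intro x hx
  simp only [Finset.mem_filter, Finset.mem_univ, true_and] at hx ⊢
  linarith

lemma erank_lt {G : Type*} [Fintype G] (s : G → ℝ) {t : ℝ} {y : G} (h : t < s y) :
    erank s t < erank s (s y) := by
  apply Finset.card_lt_card
  rw [Finset.ssubset_iff_of_subset]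
  · exact ⟨y, by simp, by simpa using h⟩
  · intro x hx
    simp only [Finset.mem_filter, Finset.mem_univ, true_and] at hx ⊢
    linarith

lemma erank_inj {G : Type*} [Fintype G] (s : G → ℝ) (hs : Function.Injective s) :
    Function.Injective (fun x => erank s (s x)) := by
  intro x y hxy
  rcases lt_trichotomy (s x) (s y) with h | h | h
  · have := erank_lt s h
    simp only at hxy
    omega
  · exact hs h
  · have := erank_lt s h
    simp only at hxy
    omega

lemma erank_image {G : Type*} [Fintype G] (s : G → ℝ) (hs : Function.Injective s) :
    Finset.univ.image (fun x => erank s (s x)) = Finset.Icc 1 (Fintype.card G) := by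
  apply Finset.eq_of_subset_of_card_le
  · intro k hk
    simp only [Finset.mem_image, Finset.mem_univ, true_and] at hk
    obtain ⟨x, rfl⟩ := hk
    rw [Finset.mem_Icc]
    exact ⟨Finset.card_pos.mpr ⟨x, by simp⟩, Finset.card_le_univ _⟩
  · rw [Finset.card_image_of_injective _ (erank_inj s hs)]
    simp

lemma erank_surj {G : Type*} [Fintype G] (s : G → ℝ) (hs : Function.Injective s) (k : ℕ)
    (h1 : 1 ≤ k) (h2 : k ≤ Fintype.card G) : ∃ y, erank s (s y) = k := by
  have : k ∈ Finset.univ.image (fun x => erank s (s x)) := by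
    rw [erank_image s hs, Finset.mem_Icc]
    exact ⟨h1, h2⟩
  simpa using this

lemma erank_count {G : Type*} [Fintype G] (s : G → ℝ) (hs : Function.Injective s) (k : ℕ)
    (h2 : k ≤ Fintype.card G) :
    (Finset.univ.filter (fun x => erank s (s x) ≤ k)).card = k := by
  rw [← Finset.card_image_of_injective _ (erank_inj s hs)]
  have : (Finset.univ.filter (fun x => erank s (s x) ≤ k)).image (fun x => erank s (s x))
      = Finset.Icc 1 k := by
    ext j
    have hj := Finset.ext_iff.mp (erank_image s hs) j
    simp only [Finset.mem_image, Finset.mem_filter, Finset.mem_univ, true_and,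
      Finset.mem_Icc] at hj ⊢
    constructor
    · rintro ⟨x, hx, rfl⟩
      exact ⟨(hj.mp ⟨x, rfl⟩).1, hx⟩
    · rintro ⟨a, b⟩
      obtain ⟨x, hx⟩ := hj.mpr ⟨a, b.trans h2⟩
      exact ⟨x, hx ▸ b, hx⟩
  rw [this]
  simp

lemma equantile_eq {G : Type*} [Fintype G] [Nonempty G] (s : G → ℝ)
    (hs : Function.Injective s) (α : ℝ) (h0 : 0 < α) (h1 : α ≤ 1) :
    ∃ y, equantile s α = s y ∧ erank s (s y) = ⌈α * Fintype.card G⌉₊ ∧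
      ∀ t, s y ≤ t ↔ α ≤ ecdf s t := by
  have hn : (0 : ℝ) < Fintype.card G := by exact_mod_cast Fintype.card_pos
  obtain ⟨y, hy⟩ := erank_surj s hs ⌈α * Fintype.card G⌉₊
    (Nat.ceil_pos.mpr (by positivity)) (Nat.ceil_le.mpr (by nlinarith))
  have key : ∀ t, s y ≤ t ↔ α ≤ ecdf s t := by
    intro t
    have e : α ≤ ecdf s t ↔ ⌈α * Fintype.card G⌉₊ ≤ erank s t := by
      rw [Nat.ceil_le]
      exact le_div_iff₀ hn
    rw [e, ← hy]
    constructor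
    · exact erank_mono s
    · intro h
      by_contra! h'
      have := erank_lt s h'
      omega
  refine ⟨y, ?_, hy, key⟩
  have : {t : ℝ | α ≤ ecdf s t} = Set.Ici (s y) := by
    ext t
    exact (key t).symm
  rw [equantile, this, csInf_Ici]

/-- Key computation in the proof of Proposition 1: the transformed empirical CDF
evaluated at the `l`-th reference quantile equals `⌊l·m/n⌋/m`. -/
theorem transformed_cdf_at_ref_quantile {Gr Ga : Type*} [Fintype Gr] [Fintype Ga]
    [Nonempty Gr] [Nonempty Ga]
    (sr : Gr → ℝ) (sa : Ga → ℝ)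
    (hr_inj : Function.Injective sr) (ha_inj : Function.Injective sa)
    (l : ℕ) (hl1 : 1 ≤ l) (hln : l ≤ Fintype.card Gr) :
    ecdf (fun x => equantile sr (ecdf sa (sa x)))
        (equantile sr ((l : ℝ) / (Fintype.card Gr : ℝ)))
      = (⌊((l : ℝ) * (Fintype.card Ga : ℝ)) / (Fintype.card Gr : ℝ)⌋ : ℝ)
          / (Fintype.card Ga : ℝ) := by
  have hn : (0 : ℝ) < Fintype.card Gr := by exact_mod_cast Fintype.card_pos
  have hm : (0 : ℝ) < Fintype.card Ga := by exact_mod_cast Fintype.card_pos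
  have hl0 : (0 : ℝ) < l := by exact_mod_cast hl1
  have hln' : (l : ℝ) ≤ Fintype.card Gr := by exact_mod_cast hln
  obtain ⟨y, hy, hyr, -⟩ := equantile_eq sr hr_inj ((l : ℝ) / (Fintype.card Gr : ℝ))
    (by positivity) ((div_le_one hn).mpr hln')
  rw [div_mul_cancel₀ _ hn.ne', Nat.ceil_natCast] at hyr
  have hF : ecdf sr (sr y) = (l : ℝ) / (Fintype.card Gr : ℝ) := by
    rw [← hyr]
    rfl
  set q : ℝ := ((l : ℝ) * (Fintype.card Ga : ℝ)) / (Fintype.card Gr : ℝ) with hq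
  have hq0 : 0 ≤ q := by positivity
  have hqm : ⌊q⌋₊ ≤ Fintype.card Ga := by
    apply Nat.floor_le_of_le
    rw [hq, div_le_iff₀ hn]
    nlinarith
  have hiff : ∀ x, equantile sr (ecdf sa (sa x)) ≤ sr y ↔ erank sa (sa x) ≤ ⌊q⌋₊ := by
    intro x
    have hd : ecdf sa (sa x) = (erank sa (sa x) : ℝ) / Fintype.card Ga := rfl
    have hmem := Finset.ext_iff.mp (erank_image sa ha_inj) (erank sa (sa x))
    have hx := Finset.mem_Icc.mp (hmem.mp (Finset.mem_image.mpr ⟨x, Finset.mem_univ _, rfl⟩))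
    have hx1 : (0 : ℝ) < erank sa (sa x) := by exact_mod_cast hx.1
    have hx2 : (erank sa (sa x) : ℝ) ≤ Fintype.card Ga := by exact_mod_cast hx.2
    obtain ⟨z, hz, -, hzk⟩ := equantile_eq sr hr_inj (ecdf sa (sa x))
      (by rw [hd]; positivity) (by rw [hd]; exact (div_le_one hm).mpr hx2)
    rw [hz, hzk, hF, hd, Nat.le_floor_iff hq0, hq, div_le_div_iff₀ hm hn, le_div_iff₀ hn]
  rw [hy]
  have hc := erank_count sa ha_inj ⌊q⌋₊ hqm
  unfold ecdf at hiff ⊢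
  simp only [hiff]
  rw [hc, natCast_floor_eq_intCast_floor hq0]
end

section
/- Let I_r and I_a be finite nonempty sets with injective score functions s_r : I_r → ℝ and s_a : I_a → ℝ. Write n = |I_r|, m = |I_a|, let S_r and S_a be the empirical survival functions of (I_r, s_r) and (I_a, s_a), let S_r⁻¹(α) = inf{t ∈ ℝ : 1 − S_r(t) ≥ 1 − α} for α ∈ [0,1), and define S_{a→r}(t) = (1/m)·|{x ∈ I_a : S_r⁻¹(S_a(s_a(x))) > t}|. Then for every integer l with 0 ≤ l ≤ n − 1, S_{a→r}(S_r⁻¹(l/n)) = ⌈l·m/n⌉ / m, and consequently |S_{a→r}(S_r⁻¹(l/n)) − l/n| < 1/m. -/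
/-- Number of points with score above `t`. -/
noncomputable def cnt {G : Type*} [Fintype G] (s : G → ℝ) (t : ℝ) : ℕ :=
  (Finset.univ.filter (fun x => s x > t)).card

lemma cnt_anti {G : Type*} [Fintype G] (s : G → ℝ) {t u : ℝ} (h : t ≤ u) :
    cnt s u ≤ cnt s t := by
  unfold cnt
  apply Finset.card_le_card
  intro y hy
  simp only [Finset.mem_filter, Finset.mem_univ, true_and] at hy ⊢
  exact lt_of_le_of_lt h hy

lemma cnt_lt {G : Type*} [Fintype G] (s : G → ℝ) {t : ℝ} {x : G} (h : t < s x) :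
    cnt s (s x) < cnt s t := by
  unfold cnt
  apply Finset.card_lt_card
  rw [Finset.ssubset_iff_of_subset]
  · exact ⟨x, by simpa using h, by simp⟩
  · intro y hy
    simp only [Finset.mem_filter, Finset.mem_univ, true_and] at hy ⊢
    exact lt_trans h hy

lemma cnt_inj {G : Type*} [Fintype G] (s : G → ℝ) (hs : Function.Injective s) :
    Function.Injective (fun x => cnt s (s x)) := by
  intro x y hxy
  simp only at hxy
  apply hs
  rcases lt_trichotomy (s x) (s y) with h | h | h
  · have := cnt_lt s h
    omega
  · exact h
  · have := cnt_lt s h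
    omega

lemma cnt_lt_card {G : Type*} [Fintype G] (s : G → ℝ) (x : G) :
    cnt s (s x) < Fintype.card G := by
  unfold cnt
  rw [← Finset.card_univ]
  apply Finset.card_lt_card
  rw [Finset.ssubset_iff_of_subset (Finset.subset_univ _)]
  exact ⟨x, Finset.mem_univ _, by simp⟩

lemma cnt_image {G : Type*} [Fintype G] (s : G → ℝ) (hs : Function.Injective s) :
    Finset.univ.image (fun x => cnt s (s x)) = Finset.range (Fintype.card G) := by
  apply Finset.eq_of_subset_of_card_le
  · intro k hk
    simp only [Finset.mem_image, Finset.mem_univ, true_and] at hk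
    obtain ⟨x, rfl⟩ := hk
    exact Finset.mem_range.2 (cnt_lt_card s x)
  · rw [Finset.card_image_of_injective _ (cnt_inj s hs), Finset.card_range, Finset.card_univ]

lemma cnt_surj {G : Type*} [Fintype G] (s : G → ℝ) (hs : Function.Injective s)
    {k : ℕ} (hk : k < Fintype.card G) : ∃ x, cnt s (s x) = k := by
  have : k ∈ Finset.univ.image (fun x => cnt s (s x)) := by
    rw [cnt_image s hs]
    exact Finset.mem_range.2 hk
  simpa using this

lemma card_cnt_lt {G : Type*} [Fintype G] (s : G → ℝ) (hs : Function.Injective s)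
    {c : ℕ} (hc : c ≤ Fintype.card G) :
    (Finset.univ.filter (fun x => cnt s (s x) < c)).card = c := by
  rw [← Finset.card_image_of_injective _ (cnt_inj s hs)]
  have : (Finset.univ.filter (fun x => cnt s (s x) < c)).image (fun x => cnt s (s x))
      = Finset.range c := by
    ext k
    simp only [Finset.mem_image, Finset.mem_filter, Finset.mem_univ, true_and, Finset.mem_range]
    constructor
    · rintro ⟨x, h, rfl⟩
      exact h
    · intro h
      obtain ⟨x, rfl⟩ := cnt_surj s hs (lt_of_lt_of_le h hc)
      exact ⟨x, h, rfl⟩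
  rw [this, Finset.card_range]

lemma esurvInv_eq {G : Type*} [Fintype G] (s : G → ℝ) {α : ℝ} (h0 : 0 ≤ α)
    {x : G} (hx : cnt s (s x) = ⌊α * Fintype.card G⌋₊) : esurvInv s α = s x := by
  have hn : (0 : ℝ) < Fintype.card G := by
    exact_mod_cast Fintype.card_pos_iff.2 ⟨x⟩
  have : {t : ℝ | 1 - α ≤ 1 - esurv s t} = Set.Ici (s x) := by
    ext t
    have e : esurv s t = (cnt s t : ℝ) / Fintype.card G := rfl
    have e2 : 1 - α ≤ 1 - esurv s t ↔ cnt s t ≤ cnt s (s x) := by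
      rw [hx, Nat.le_floor_iff (by positivity), ← div_le_iff₀ hn, e]
      constructor <;> intro h <;> linarith
    rw [Set.mem_setOf_eq, e2, Set.mem_Ici]
    constructor
    · intro h
      by_contra hlt
      have := cnt_lt s (not_le.1 hlt)
      omega
    · exact cnt_anti s
  unfold esurvInv
  rw [this, csInf_Ici]

/-- FAR-side analogue of the key computation in the proof of Proposition 1:
for `0 ≤ l ≤ n − 1`, `S_{a→r}(S_r⁻¹(l/n)) = ⌈l·m/n⌉/m`, and consequently
`|S_{a→r}(S_r⁻¹(l/n)) − l/n| < 1/m`. -/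
theorem transformed_surv_at_ref_quantile {Ir Ia : Type*} [Fintype Ir] [Fintype Ia]
    [Nonempty Ir] [Nonempty Ia]
    (sr : Ir → ℝ) (sa : Ia → ℝ)
    (hr_inj : Function.Injective sr) (ha_inj : Function.Injective sa)
    (l : ℕ) (hln : l ≤ Fintype.card Ir - 1) :
    esurv (fun x => esurvInv sr (esurv sa (sa x)))
        (esurvInv sr ((l : ℝ) / (Fintype.card Ir : ℝ)))
      = (⌈((l : ℝ) * (Fintype.card Ia : ℝ)) / (Fintype.card Ir : ℝ)⌉ : ℝ)
          / (Fintype.card Ia : ℝ) ∧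
    |esurv (fun x => esurvInv sr (esurv sa (sa x)))
        (esurvInv sr ((l : ℝ) / (Fintype.card Ir : ℝ)))
      - (l : ℝ) / (Fintype.card Ir : ℝ)| < 1 / (Fintype.card Ia : ℝ) := by
  have hn : (0 : ℝ) < Fintype.card Ir := by exact_mod_cast Fintype.card_pos
  have hm : (0 : ℝ) < Fintype.card Ia := by exact_mod_cast Fintype.card_pos
  have hl : l < Fintype.card Ir := by
    have : 0 < Fintype.card Ir := Fintype.card_pos
    omega
  have hl' : (l : ℝ) < Fintype.card Ir := by exact_mod_cast hl
  obtain ⟨xl, hxl⟩ := cnt_surj sr hr_inj hl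
  have hq : esurvInv sr ((l : ℝ) / (Fintype.card Ir : ℝ)) = sr xl := by
    apply esurvInv_eq sr (by positivity)
    rw [div_mul_cancel₀ _ hn.ne', Nat.floor_natCast, hxl]
  set c : ℕ := ⌈((l : ℝ) * (Fintype.card Ia : ℝ)) / (Fintype.card Ir : ℝ)⌉₊ with hcdef
  have hc : c ≤ Fintype.card Ia := by
    rw [hcdef, Nat.ceil_le, div_le_iff₀ hn]
    nlinarith
  have key : ∀ x, esurvInv sr (esurv sa (sa x)) > sr xl ↔ cnt sa (sa x) < c := by
    intro x
    have e : esurv sa (sa x) = (cnt sa (sa x) : ℝ) / Fintype.card Ia := rfl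
    have h0 : 0 ≤ esurv sa (sa x) := by rw [e]; positivity
    have h1 : esurv sa (sa x) < 1 := by
      rw [e, div_lt_one hm]
      exact_mod_cast cnt_lt_card sa x
    have hk : ⌊esurv sa (sa x) * Fintype.card Ir⌋₊ < Fintype.card Ir := by
      rw [Nat.floor_lt (by positivity)]
      nlinarith
    obtain ⟨y, hy⟩ := cnt_surj sr hr_inj hk
    rw [esurvInv_eq sr h0 hy]
    have h2 : sr y > sr xl ↔ cnt sr (sr y) < l := by
      rw [← hxl]
      constructor
      · exact fun h => cnt_lt sr h
      · intro h
        by_contra hle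
        have := cnt_anti sr (not_lt.1 hle)
        omega
    rw [h2, hy, Nat.floor_lt (by positivity), hcdef, Nat.lt_ceil, e, lt_div_iff₀ hn,
      div_mul_eq_mul_div, div_lt_iff₀ hm]
  have main : esurv (fun x => esurvInv sr (esurv sa (sa x)))
        (esurvInv sr ((l : ℝ) / (Fintype.card Ir : ℝ))) = (c : ℝ) / Fintype.card Ia := by
    rw [hq, esurv]
    simp only [key]
    rw [card_cnt_lt sa ha_inj hc]
  have hci : (⌈((l : ℝ) * (Fintype.card Ia : ℝ)) / (Fintype.card Ir : ℝ)⌉ : ℝ) = (c : ℝ) := by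
    rw [hcdef, natCast_ceil_eq_intCast_ceil (by positivity)]
  rw [main, hci]
  refine ⟨rfl, ?_⟩
  have a1 : ((l : ℝ) * (Fintype.card Ia : ℝ)) / (Fintype.card Ir : ℝ) ≤ c := Nat.le_ceil _
  have a2 : (c : ℝ) < ((l : ℝ) * (Fintype.card Ia : ℝ)) / (Fintype.card Ir : ℝ) + 1 :=
    Nat.ceil_lt_add_one (by positivity)
  have e3 : (c : ℝ) / Fintype.card Ia - (l : ℝ) / (Fintype.card Ir : ℝ)
      = (c - ((l : ℝ) * (Fintype.card Ia : ℝ)) / (Fintype.card Ir : ℝ)) / Fintype.card Ia := by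
    field_simp
  rw [e3, abs_of_nonneg (div_nonneg (by linarith) hm.le)]
  exact div_lt_div_of_pos_right (by linarith) hm
end
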